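/- Let 0 < m < 1/2 and 0 < b < 1, and set t ∈ ((m/(1-m))², m/(1-m)). Define x₁ = x₁(t) as the unique solution in (0,1) of x^{2m} - t·x^{2m-2} - (1-t)·b^{2m} = 0, and define τ₁(t) = (m/b)·x₁^{2m-1}/((x₁^{2m-2} - b^{2m})·((1-m)t + m)). Similarly define x₂ = x₂(t) as the unique solution in (0,1) of (m-1)²·t·(x^{2m} - b^{2m}) = m²·(x^{2m-2} - b^{2m}), and τ₃(t) = (m/b)·(x₂^{2m-1}/(x₂^{2m-2} - b^{2m}))·((1-m)t/(m(m + (1-m)t))). Then τ₁(t) < τ₃(t) for all t in ((m/(1-m))², m/(1-m)). -/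

import Mathlib

theorem rpow_comparison {m κ w r ρ B : ℝ} (hm0 : 0 < m) (hm1 : m < 1) (hκ : κ * (1 - m) = m)
    (hκw : κ < w) (hw1 : w < 1) (hr0 : 0 < r) (hr1 : r < 1) (hρ0 : 0 < ρ) (hB : 0 < B)
    (hρ : ρ - B * ρ ^ (1 - m) = κ * w * (1 - B * ρ ^ (1 - m)))
    (hr : r - B * r ^ (1 - m) = κ / w * (1 - B * r ^ (1 - m))) :
    (ρ - κ * w) * ((w - κ) * (w * r + 1)) < (w * r - κ) * ((1 - κ * w) * (ρ + w)) := by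
  have hκ0 : 0 < κ := by
    by_contra! h
    nlinarith
  have hw0 : 0 < w := hκ0.trans hκw
  have hκw1 : 0 < 1 - κ * w := by nlinarith
  have hρ' : ρ - κ * w = (1 - κ * w) * (B * ρ ^ (1 - m)) := by linarith
  have hr' : w * r - κ = (w - κ) * (B * r ^ (1 - m)) := by
    field_simp at hr
    linarith
  have hrpos : 0 < r ^ (1 - m) := Real.rpow_pos_of_pos hr0 _
  have hwr : 0 < w * r - κ := by
    rw [hr']
    exact mul_pos (by linarith) (by positivity)
  set V := (1 - κ) - (1 - w) * r with hV
  set W := w * (1 - κ) * r - κ * (1 - w) with hW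
  have hV0 : 0 < V := by nlinarith
  have hW0 : 0 < W := by nlinarith [mul_pos hκ0 (mul_pos hw0 (sub_pos.2 hr1))]
  by_contra! hcon
  have hle : W ≤ ρ * V := by
    have h : w * (1 + κ) * W ≤ w * (1 + κ) * (ρ * V) := by
      rw [hV, hW]
      nlinarith
    exact le_of_mul_le_mul_left h (by positivity)
  -- the value of `ρ` at which equality would hold
  set σ := W / V with hσ
  have hσ0 : 0 < σ := by positivity
  have hσρ : σ ≤ ρ := by rwa [hσ, div_le_iff₀ hV0]
  have hσκ : σ - κ * w = (1 - κ * w) * (w * r - κ) / V := by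
    rw [hσ]
    field_simp
    rw [hV, hW]
    ring
  have hσκ0 : 0 < σ - κ * w := by
    rw [hσκ]
    positivity
  have hamgm : (W / r) ^ (1 - m) * V ^ m ≤ (1 - m) * (W / r) + m * V :=
    Real.geom_mean_le_arith_mean2_weighted (by linarith) hm0.le (by positivity) hV0.le (by ring)
  have hsum : (1 - m) * (W / r) + m * V < w - κ := by
    have h : (w - κ) - ((1 - m) * (W / r) + m * V) = m * (1 - w) * (1 - r) ^ 2 / r := by
      have hm : (1 - m) * (1 + κ) = 1 := by linarith
      have h' : (1 + κ) * (w - κ) - (W / r + κ * V) = κ * (1 - w) * (1 - r) ^ 2 / r := by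
        rw [hV, hW]
        field_simp
        ring
      have e1 : (w - κ) - ((1 - m) * (W / r) + m * V)
          = (1 - m) * ((1 + κ) * (w - κ) - (W / r + κ * V)) := by
        linear_combination (-(w - κ)) * hm + V * hκ
      rw [e1, h']
      linear_combination (1 - w) * (1 - r) ^ 2 / r * hκ
    have : 0 < m * (1 - w) * (1 - r) ^ 2 / r := by
      have := sub_pos.2 hw1
      have := sub_pos.2 hr1
      positivity
    linarith
  have hσr : σ ^ (1 - m) * V = (W / r) ^ (1 - m) * V ^ m * r ^ (1 - m) := by
    rw [hσ, Real.div_rpow hW0.le hV0.le, Real.div_rpow hW0.le hr0.le]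
    have h : V ^ (1 - m) * V ^ m = V := by
      rw [← Real.rpow_add hV0]
      simp
    have hVp : 0 < V ^ (1 - m) := Real.rpow_pos_of_pos hV0 _
    field_simp
    linear_combination -h
  have hlt : (1 - κ * w) * (B * σ ^ (1 - m)) < σ - κ * w := by
    rw [hσκ, lt_div_iff₀ hV0, hr']
    calc (1 - κ * w) * (B * σ ^ (1 - m)) * V
        = (1 - κ * w) * (B * r ^ (1 - m)) * ((W / r) ^ (1 - m) * V ^ m) := by
          linear_combination (1 - κ * w) * B * hσr
      _ < (1 - κ * w) * (B * r ^ (1 - m)) * (w - κ) := by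
          have := hamgm.trans_lt hsum
          gcongr
      _ = _ := by ring
  have hquot : ρ ^ (1 - m) ≤ ρ / σ * σ ^ (1 - m) := by
    have h1 : 1 ≤ ρ / σ := by rwa [one_le_div hσ0]
    have h2 : (ρ / σ) ^ (1 - m) ≤ ρ / σ := Real.rpow_le_self_of_one_le h1 (by linarith)
    rw [Real.div_rpow hρ0.le hσ0.le, div_le_iff₀ (Real.rpow_pos_of_pos hσ0 _)] at h2
    exact h2
  have h3 : ρ - κ * w < ρ / σ * (σ - κ * w) := by
    calc ρ - κ * w = (1 - κ * w) * (B * ρ ^ (1 - m)) := hρ'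
      _ ≤ (1 - κ * w) * (B * (ρ / σ * σ ^ (1 - m))) := by gcongr
      _ = ρ / σ * ((1 - κ * w) * (B * σ ^ (1 - m))) := by ring
      _ < _ := by gcongr
  have h4 : ρ / σ * (σ - κ * w) = ρ - ρ / σ * (κ * w) := by
    field_simp
  have h5 : κ * w ≤ ρ / σ * (κ * w) :=
    le_mul_of_one_le_left (by positivity) (by rwa [one_le_div hσ0])
  linarith

theorem exists_hasDerivAt_inverse {m β : ℝ} (hm0 : 0 < m) (hm1 : m < 1) (hβ0 : 0 < β)
    (hβ1 : β < 1) :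
    ∃ R : ℝ → ℝ,
      (∀ γ ∈ Set.Ioo (0 : ℝ) 1, R γ ∈ Set.Ioo 0 1 ∧
        R γ - β ^ m * R γ ^ (1 - m) = γ * (1 - β ^ m * R γ ^ (1 - m)) ∧
        HasDerivAt R (R γ * (1 - R γ) / ((1 - γ) * (m * R γ + (1 - m) * γ))) γ) ∧
      ∀ ρ ∈ Set.Ioo (0 : ℝ) 1, ∀ γ ∈ Set.Ioo (0 : ℝ) 1,
        ρ - β ^ m * ρ ^ (1 - m) = γ * (1 - β ^ m * ρ ^ (1 - m)) → R γ = ρ := by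
  set B := β ^ m with hB
  have hB0 : 0 < B := Real.rpow_pos_of_pos hβ0 _
  have hB1 : B < 1 := Real.rpow_lt_one hβ0.le hβ1 hm0
  have hq1 : ∀ ρ ∈ Set.Icc β 1, 0 < 1 - B * ρ ^ (1 - m) := by
    intro ρ hρ
    have h : ρ ^ (1 - m) ≤ 1 :=
      Real.rpow_le_one (hβ0.le.trans hρ.1) hρ.2 (by linarith)
    nlinarith
  have hfac : ∀ ρ : ℝ, 0 < ρ → ρ - B * ρ ^ (1 - m) = ρ ^ (1 - m) * (ρ ^ m - B) := by
    intro ρ hρ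
    have h : ρ ^ (1 - m) * ρ ^ m = ρ := by
      rw [← Real.rpow_add hρ]
      simp
    linear_combination -h
  have hqβ : β - B * β ^ (1 - m) = 0 := by
    rw [hfac β hβ0, hB]
    ring
  have hqpos : ∀ ρ : ℝ, 0 < ρ → (0 < ρ - B * ρ ^ (1 - m) ↔ β < ρ) := by
    intro ρ hρ
    rw [hfac ρ hρ, mul_pos_iff_of_pos_left (Real.rpow_pos_of_pos hρ _), sub_pos, hB,
      Real.rpow_lt_rpow_iff hβ0.le hρ.le hm0]
  set G : ℝ → ℝ := fun ρ => (ρ - B * ρ ^ (1 - m)) / (1 - B * ρ ^ (1 - m)) with hG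
  have hGderiv : ∀ ρ ∈ Set.Ioo β 1, HasDerivAt G
      ((ρ * (1 - B * ρ ^ (1 - m)) - (1 - m) * (B * ρ ^ (1 - m)) * (1 - ρ)) /
        (ρ * (1 - B * ρ ^ (1 - m)) ^ 2)) ρ := by
    intro ρ hρ
    have hρ0 : 0 < ρ := hβ0.trans hρ.1
    have h1 := hq1 ρ ⟨hρ.1.le, hρ.2.le⟩
    have hp : HasDerivAt (fun ρ : ℝ => B * ρ ^ (1 - m)) (B * ((1 - m) * (ρ ^ (1 - m) / ρ))) ρ := by
      have := (Real.hasDerivAt_rpow_const (p := 1 - m) (Or.inl hρ0.ne')).const_mul B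
      rwa [Real.rpow_sub_one hρ0.ne'] at this
    refine (((hasDerivAt_id ρ).sub hp).div (hp.const_sub 1) h1.ne').congr_deriv ?_
    simp only [id, Pi.sub_apply]
    field_simp
    ring
  have hGcont : ContinuousOn G (Set.Icc β 1) := by
    have hp : ContinuousOn (fun ρ : ℝ => B * ρ ^ (1 - m)) (Set.Icc β 1) :=
      continuousOn_const.mul
        (continuousOn_id.rpow_const fun x _ => Or.inr (by linarith))
    exact (continuousOn_id.sub hp).div (continuousOn_const.sub hp) fun x hx => (hq1 x hx).ne'
  have hnum : ∀ ρ ∈ Set.Ioo β 1,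
      0 < ρ * (1 - B * ρ ^ (1 - m)) - (1 - m) * (B * ρ ^ (1 - m)) * (1 - ρ) := by
    intro ρ hρ
    have hρ0 : 0 < ρ := hβ0.trans hρ.1
    have h1 := (hqpos ρ hρ0).2 hρ.1
    have h2 : 0 < m * (B * ρ ^ (1 - m)) * (1 - ρ) := by
      have := sub_pos.2 hρ.2
      positivity
    linarith
  have hGmono : StrictMonoOn G (Set.Icc β 1) := by
    refine strictMonoOn_of_deriv_pos (convex_Icc β 1) hGcont fun ρ hρ => ?_
    rw [interior_Icc] at hρ
    rw [(hGderiv ρ hρ).deriv]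
    have hρ0 : 0 < ρ := hβ0.trans hρ.1
    have h1 := hq1 ρ ⟨hρ.1.le, hρ.2.le⟩
    exact div_pos (hnum ρ hρ) (by positivity)
  have hGβ : G β = 0 := by simp only [hG, hqβ, zero_div]
  have hG1 : G 1 = 1 := by
    simp only [hG, Real.one_rpow, mul_one]
    exact div_self (by linarith)
  have hβI : β ∈ Set.Icc β 1 := ⟨le_rfl, hβ1.le⟩
  have h1I : (1 : ℝ) ∈ Set.Icc β 1 := ⟨hβ1.le, le_rfl⟩
  set R := Function.invFunOn G (Set.Icc β 1) with hR
  have hRG : ∀ ρ ∈ Set.Icc β 1, R (G ρ) = ρ := fun ρ hρ =>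
    hGmono.injOn.leftInvOn_invFunOn hρ
  have hRmem : ∀ γ ∈ Set.Ioo (0 : ℝ) 1, R γ ∈ Set.Ioo β 1 ∧ G (R γ) = γ := by
    intro γ hγ
    have hex : γ ∈ G '' Set.Icc β 1 := by
      refine intermediate_value_Icc hβ1.le hGcont ?_
      rw [hGβ, hG1]
      exact ⟨hγ.1.le, hγ.2.le⟩
    have hI : R γ ∈ Set.Icc β 1 := Function.invFunOn_mem hex
    have hE : G (R γ) = γ := Function.invFunOn_eq hex
    refine ⟨⟨?_, ?_⟩, hE⟩
    · rw [← hGmono.lt_iff_lt hβI hI, hGβ, hE]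
      exact hγ.1
    · rw [← hGmono.lt_iff_lt hI h1I, hG1, hE]
      exact hγ.2
  have hRmono : StrictMonoOn R (Set.Ioo 0 1) := by
    intro γ hγ δ hδ hlt
    obtain ⟨h1, h2⟩ := hRmem γ hγ
    obtain ⟨h3, h4⟩ := hRmem δ hδ
    rwa [← hGmono.lt_iff_lt (Set.Ioo_subset_Icc_self h1) (Set.Ioo_subset_Icc_self h3), h2, h4]
  refine ⟨R, fun γ hγ => ?_, fun ρ hρ γ hγ h => ?_⟩
  · obtain ⟨hI, hE⟩ := hRmem γ hγ
    have hR0 : 0 < R γ := hβ0.trans hI.1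
    have h1 := hq1 (R γ) ⟨hI.1.le, hI.2.le⟩
    have hE' : R γ - B * R γ ^ (1 - m) = γ * (1 - B * R γ ^ (1 - m)) := (div_eq_iff h1.ne').1 hE
    refine ⟨⟨hR0, hI.2⟩, hE', ?_⟩
    have hcont : ContinuousAt R γ := by
      refine hRmono.continuousAt_of_image_mem_nhds (Ioo_mem_nhds hγ.1 hγ.2) ?_
      refine Filter.mem_of_superset (Ioo_mem_nhds hI.1 hI.2) fun ρ hρ => ?_
      have hρI := Set.Ioo_subset_Icc_self hρ
      refine ⟨G ρ, ⟨?_, ?_⟩, hRG ρ hρI⟩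
      · rw [← hGβ]
        exact hGmono hβI hρI hρ.1
      · rw [← hG1]
        exact hGmono hρI h1I hρ.2
    have hd := HasDerivAt.of_local_left_inverse hcont (hGderiv (R γ) hI)
      (div_pos (hnum _ hI) (by positivity)).ne'
      (Filter.eventually_of_mem (Ioo_mem_nhds hγ.1 hγ.2) fun δ hδ => (hRmem δ hδ).2)
    refine hd.congr_deriv ?_
    have hγ1 : 0 < 1 - γ := sub_pos.2 hγ.2
    have hq : B * R γ ^ (1 - m) = (R γ - γ) / (1 - γ) := by
      rw [eq_div_iff hγ1.ne']
      linarith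
    have hn := hnum _ hI
    have hpos : 0 < m * R γ + (1 - m) * γ := by
      have := sub_pos.2 hm1
      have := hγ.1
      positivity
    have hR1 : 0 < 1 - R γ := sub_pos.2 hI.2
    have e1 : 1 - B * R γ ^ (1 - m) = (1 - R γ) / (1 - γ) := by
      rw [hq]
      field_simp
      ring
    have e2 : R γ * ((1 - R γ) / (1 - γ)) - (1 - m) * ((R γ - γ) / (1 - γ)) * (1 - R γ)
        = (1 - R γ) * (m * R γ + (1 - m) * γ) / (1 - γ) := by
      field_simp
      ring
    rw [e1, hq, e2]
    field_simp
  · have hpos : 0 < ρ - B * ρ ^ (1 - m) := by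
      rw [h]
      refine mul_pos hγ.1 ?_
      have h1 : ρ ^ (1 - m) ≤ 1 := Real.rpow_le_one hρ.1.le hρ.2.le (by linarith)
      nlinarith
    have hI : ρ ∈ Set.Icc β 1 := ⟨((hqpos ρ hρ.1).1 hpos).le, hρ.2.le⟩
    rw [← hRG ρ hI]
    congr 1
    exact (eq_div_iff (hq1 ρ hI).ne').2 h.symm

theorem hasDerivAt_log_comb {R : ℝ → ℝ} {m γ : ℝ} (hm0 : 0 < m) (hm1 : m < 1)
    (hγ : γ ∈ Set.Ioo (0 : ℝ) 1) (hRγ : R γ ∈ Set.Ioo (0 : ℝ) 1)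
    (hd : HasDerivAt R (R γ * (1 - R γ) / ((1 - γ) * (m * R γ + (1 - m) * γ))) γ) :
    HasDerivAt
      (fun γ => Real.log γ + 2 * Real.log (1 - R γ) - Real.log (R γ) - 2 * Real.log (1 - γ))
      ((R γ - γ) * (m - (1 - m) * γ) / (γ * (1 - γ) * (m * R γ + (1 - m) * γ))) γ := by
  obtain ⟨hγ0, hγ1⟩ := hγ
  obtain ⟨hR0, hR1⟩ := hRγ
  have hγ1' : 0 < 1 - γ := sub_pos.2 hγ1
  have hR1' : 0 < 1 - R γ := sub_pos.2 hR1
  have hm1' : 0 < 1 - m := sub_pos.2 hm1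
  have hpos : 0 < m * R γ + (1 - m) * γ := by positivity
  refine ((((Real.hasDerivAt_log hγ0.ne').add
    (((hd.const_sub 1).log hR1'.ne').const_mul 2)).sub (hd.log hR0.ne')).sub
    ((((hasDerivAt_id γ).const_sub 1).log hγ1'.ne').const_mul 2)).congr_deriv ?_
  simp only [id]
  field_simp
  ring

theorem log_comb_lt {R : ℝ → ℝ} {m κ s B : ℝ} (hm0 : 0 < m) (hm1 : m < 1)
    (hκ : κ * (1 - m) = m) (hκs : κ < s) (hs1 : s < 1) (hB : 0 < B)
    (hR : ∀ γ ∈ Set.Ioo (0 : ℝ) 1, R γ ∈ Set.Ioo 0 1 ∧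
      R γ - B * R γ ^ (1 - m) = γ * (1 - B * R γ ^ (1 - m)) ∧
      HasDerivAt R (R γ * (1 - R γ) / ((1 - γ) * (m * R γ + (1 - m) * γ))) γ) :
    Real.log (κ / s) + 2 * Real.log (1 - R (κ / s)) - Real.log (R (κ / s))
        - 2 * Real.log (1 - κ / s) <
      Real.log (κ * s) + 2 * Real.log (1 - R (κ * s)) - Real.log (R (κ * s))
        - 2 * Real.log (1 - κ * s) := by
  have hm1' : 0 < 1 - m := sub_pos.2 hm1
  have hκ0 : 0 < κ := by
    by_contra! h
    nlinarith
  set Φ : ℝ → ℝ :=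
    fun γ => Real.log γ + 2 * Real.log (1 - R γ) - Real.log (R γ) - 2 * Real.log (1 - γ) with hΦ
  set Λ : ℝ → ℝ :=
    fun γ => (R γ - γ) * (m - (1 - m) * γ) / (γ * (1 - γ) * (m * R γ + (1 - m) * γ)) with hΛ
  have hΦd : ∀ γ ∈ Set.Ioo (0 : ℝ) 1, HasDerivAt Φ (Λ γ) γ := fun γ hγ =>
    hasDerivAt_log_comb hm0 hm1 hγ (hR γ hγ).1 (hR γ hγ).2.2
  have hmul : ∀ w ∈ Set.Icc s 1, κ * w ∈ Set.Ioo (0 : ℝ) 1 := fun w hw =>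
    have hw0 : 0 < w := hκ0.trans (hκs.trans_le hw.1)
    ⟨by positivity, by nlinarith [hw.2]⟩
  have hdiv : ∀ w ∈ Set.Icc s 1, κ / w ∈ Set.Ioo (0 : ℝ) 1 := fun w hw =>
    have hw0 : 0 < w := hκ0.trans (hκs.trans_le hw.1)
    ⟨by positivity, (div_lt_one hw0).2 (hκs.trans_le hw.1)⟩
  have hΨd : ∀ w ∈ Set.Icc s 1, HasDerivAt (fun w => Φ (κ * w) - Φ (κ / w))
      (Λ (κ * w) * κ - Λ (κ / w) * (-κ / w ^ 2)) w := by
    intro w hw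
    have hw0 : 0 < w := hκ0.trans (hκs.trans_le hw.1)
    have h1 : HasDerivAt (fun w => κ * w) κ w := by
      simpa using (hasDerivAt_id w).const_mul κ
    have h2 : HasDerivAt (fun w => κ / w) (-κ / w ^ 2) w :=
      ((hasDerivAt_const w κ).div (hasDerivAt_id w) hw0.ne').congr_deriv (by simp)
    exact ((hΦd _ (hmul w hw)).comp w h1).sub ((hΦd _ (hdiv w hw)).comp w h2)
  have hanti : StrictAntiOn (fun w => Φ (κ * w) - Φ (κ / w)) (Set.Icc s 1) := by
    refine strictAntiOn_of_deriv_neg (convex_Icc s 1)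
      (fun w hw => (hΨd w hw).continuousAt.continuousWithinAt) fun w hw => ?_
    rw [interior_Icc] at hw
    have hwI := Set.Ioo_subset_Icc_self hw
    rw [(hΨd w hwI).deriv]
    have hκw : κ < w := hκs.trans hw.1
    have hw0 : 0 < w := hκ0.trans hκw
    obtain ⟨⟨hρ0, hρ1⟩, hρe, -⟩ := hR _ (hmul w hwI)
    obtain ⟨⟨hr0, hr1⟩, hre, -⟩ := hR _ (hdiv w hwI)
    have hkey := rpow_comparison hm0 hm1 hκ hκw hw.2 hr0 hr1 hρ0 hB hρe hre
    have hκw1 : 0 < 1 - κ * w := sub_pos.2 (hmul w hwI).2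
    have hwκ : 0 < w - κ := sub_pos.2 hκw
    have hw1 : 0 < 1 - w := sub_pos.2 hw.2
    simp only [hΛ]
    generalize R (κ * w) = ρ at *
    generalize R (κ / w) = r at *
    have hsplit : (ρ - κ * w) * (m - (1 - m) * (κ * w)) /
          (κ * w * (1 - κ * w) * (m * ρ + (1 - m) * (κ * w))) * κ -
        (r - κ / w) * (m - (1 - m) * (κ / w)) /
          (κ / w * (1 - κ / w) * (m * r + (1 - m) * (κ / w))) * (-κ / w ^ 2) =
        (1 - w) / w * ((ρ - κ * w) / ((1 - κ * w) * (ρ + w)) -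
          (w * r - κ) / ((w - κ) * (w * r + 1))) := by
      have e1 : m - (1 - m) * (κ * w) = m * (1 - w) := by linear_combination (-w) * hκ
      have e2 : m - (1 - m) * (κ / w) = -(m * (1 - w) / w) := by
        field_simp
        linear_combination -hκ
      have e3 : m * ρ + (1 - m) * (κ * w) = m * (ρ + w) := by linear_combination w * hκ
      have e4 : m * r + (1 - m) * (κ / w) = m * (w * r + 1) / w := by
        field_simp
        linear_combination hκ
      have e5 : 1 - κ / w = (w - κ) / w := by field_simp
      have e6 : r - κ / w = (w * r - κ) / w := by field_simp
      rw [e1, e2, e3, e4, e5, e6]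
      field_simp
    rw [hsplit]
    refine mul_neg_of_pos_of_neg (by positivity) ?_
    rw [sub_neg, div_lt_div_iff₀ (by positivity) (by positivity)]
    exact hkey
  have h := hanti (Set.left_mem_Icc.2 hs1.le) (Set.right_mem_Icc.2 hs1.le) hs1
  simp only [mul_one, div_one, sub_self, sub_pos] at h
  exact h

theorem rpow_quotient_facts {m b γ x : ℝ} (hm0 : 0 < m) (hm1 : m < 1) (hb0 : 0 < b)
    (hb1 : b < 1) (hx : x ∈ Set.Ioo (0 : ℝ) 1)
    (h : x ^ (2 * m) - b ^ (2 * m) = γ * (x ^ (2 * m - 2) - b ^ (2 * m))) :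
    x ^ 2 - (b ^ 2) ^ m * (x ^ 2) ^ (1 - m) = γ * (1 - (b ^ 2) ^ m * (x ^ 2) ^ (1 - m)) ∧
      x ^ (2 * m - 1) / (x ^ (2 * m - 2) - b ^ (2 * m)) = x * (1 - γ) / (1 - x ^ 2) := by
  obtain ⟨hx0, hx1⟩ := hx
  have hB : (b ^ 2) ^ m = b ^ (2 * m) := by
    rw [Real.rpow_mul hb0.le, Real.rpow_two]
  have hY0 : 0 < x ^ (2 * m - 2) := Real.rpow_pos_of_pos hx0 _
  have hY : (x ^ 2) ^ (1 - m) = (x ^ (2 * m - 2))⁻¹ := by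
    rw [← Real.rpow_neg hx0.le, ← Real.rpow_two, ← Real.rpow_mul hx0.le]
    congr 1
    ring
  have hX : x ^ (2 * m) = x ^ (2 * m - 2) * x ^ 2 := by
    rw [← Real.rpow_two, ← Real.rpow_add hx0]
    congr 1
    ring
  have hZ : x ^ (2 * m - 1) = x ^ (2 * m - 2) * x := by
    rw [← Real.rpow_add_one hx0.ne']
    congr 1
    ring
  have hYB : 0 < x ^ (2 * m - 2) - b ^ (2 * m) := by
    have h1 : 1 < x ^ (2 * m - 2) := Real.one_lt_rpow_of_pos_of_lt_one_of_neg hx0 hx1 (by linarith)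
    have h2 : b ^ (2 * m) < 1 := Real.rpow_lt_one hb0.le hb1 (by linarith)
    linarith
  have hx2 : 0 < 1 - x ^ 2 := by nlinarith
  rw [hX] at h
  rw [hB, hY, hZ]
  generalize x ^ (2 * m - 2) = Y at *
  generalize b ^ (2 * m) = B at *
  refine ⟨?_, ?_⟩
  · field_simp
    linear_combination h
  · rw [div_eq_div_iff hYB.ne' hx2.ne']
    linear_combination -x * h

theorem stmt18 (m b : ℝ) (hm0 : 0 < m) (hm1 : m < 1/2) (hb0 : 0 < b) (hb1 : b < 1)
    (t x1 x2 : ℝ)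
    (ht : t ∈ Set.Ioo ((m / (1 - m)) ^ 2) (m / (1 - m)))
    (hx1 : x1 ∈ Set.Ioo (0 : ℝ) 1)
    (he1 : x1 ^ (2 * m) - t * x1 ^ (2 * m - 2) - (1 - t) * b ^ (2 * m) = 0)
    (hx2 : x2 ∈ Set.Ioo (0 : ℝ) 1)
    (he2 : (m - 1) ^ 2 * t * (x2 ^ (2 * m) - b ^ (2 * m)) =
      m ^ 2 * (x2 ^ (2 * m - 2) - b ^ (2 * m))) :
    (m / b) * x1 ^ (2 * m - 1) / ((x1 ^ (2 * m - 2) - b ^ (2 * m)) * ((1 - m) * t + m)) <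
      (m / b) * (x2 ^ (2 * m - 1) / (x2 ^ (2 * m - 2) - b ^ (2 * m))) *
        ((1 - m) * t / (m * (m + (1 - m) * t))) := by
  have hm1' : m < 1 := by linarith
  have hm : 0 < 1 - m := sub_pos.2 hm1'
  set κ := m / (1 - m) with hκdef
  have hκ : κ * (1 - m) = m := div_mul_cancel₀ _ hm.ne'
  have hκ0 : 0 < κ := by positivity
  have hκ1 : κ < 1 := (div_lt_one hm).2 (by linarith)
  obtain ⟨ht1, ht2⟩ := ht
  have ht0 : 0 < t := lt_trans (by positivity) ht1
  obtain ⟨s, hs⟩ : ∃ s, t = κ * s := ⟨t / κ, by field_simp⟩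
  have hκs : κ < s := by nlinarith
  have hs1 : s < 1 := by nlinarith
  have hs0 : 0 < s := hκ0.trans hκs
  have hdiv0 : 0 < κ / s := by positivity
  have hdiv1 : κ / s < 1 := (div_lt_one hs0).2 hκs
  have ht1' : t < 1 := ht2.trans hκ1
  obtain ⟨hq1, hf1⟩ := rpow_quotient_facts (γ := κ * s) hm0 hm1' hb0 hb1 hx1
    (by rw [← hs]; linarith)
  obtain ⟨hq2, hf2⟩ := rpow_quotient_facts (γ := κ / s) hm0 hm1' hb0 hb1 hx2 (by
    have hmm : m ^ 2 = κ ^ 2 * (1 - m) ^ 2 := by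
      linear_combination (-(κ * (1 - m) + m)) * hκ
    rw [hs, hmm] at he2
    have hc : κ * (1 - m) ^ 2 ≠ 0 := by positivity
    generalize x2 ^ (2 * m - 2) = Y at *
    field_simp
    refine mul_left_cancel₀ hc ?_
    linear_combination he2)
  have hsq : ∀ {x : ℝ}, x ∈ Set.Ioo (0 : ℝ) 1 → x ^ 2 ∈ Set.Ioo (0 : ℝ) 1 := fun hx =>
    ⟨pow_pos hx.1 2, pow_lt_one₀ hx.1.le hx.2 two_ne_zero⟩
  obtain ⟨R, hR, hRu⟩ :=
    exists_hasDerivAt_inverse hm0 hm1' (hsq ⟨hb0, hb1⟩).1 (hsq ⟨hb0, hb1⟩).2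
  have hlog := log_comb_lt hm0 hm1' hκ hκs hs1 (by positivity) hR
  rw [hRu _ (hsq hx1) _ ⟨by positivity, hs ▸ ht1'⟩ hq1, hRu _ (hsq hx2) _ ⟨hdiv0, hdiv1⟩ hq2]
    at hlog
  have hx10 := hx1.1
  have hx20 := hx2.1
  have hd1 : 0 < 1 - x1 ^ 2 := sub_pos.2 (hsq hx1).2
  have hd2 : 0 < 1 - x2 ^ 2 := sub_pos.2 (hsq hx2).2
  have hd3 : 0 < 1 - κ * s := by linarith
  have hd4 : 0 < 1 - κ / s := sub_pos.2 hdiv1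
  have hmain : x1 * (1 - κ * s) / (1 - x1 ^ 2) < s * (x2 * (1 - κ / s) / (1 - x2 ^ 2)) := by
    rw [← Real.log_lt_log_iff (by positivity) (by positivity),
      Real.log_div (by positivity) hd1.ne', Real.log_mul hx10.ne' hd3.ne',
      Real.log_mul hs0.ne' (by positivity), Real.log_div (by positivity) hd2.ne',
      Real.log_mul hx20.ne' hd4.ne']
    rw [Real.log_mul hκ0.ne' hs0.ne', Real.log_div hκ0.ne' hs0.ne', Real.log_pow, Real.log_pow]
      at hlog
    push_cast at hlog
    linarith
  rw [← hf1, ← hf2] at hmain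
  have hD : 0 < m + (1 - m) * t := by positivity
  have hst : (1 - m) * t = m * s := by rw [hs]; linear_combination s * hκ
  calc _ = m / b / (m + (1 - m) * t) *
        (x1 ^ (2 * m - 1) / (x1 ^ (2 * m - 2) - b ^ (2 * m))) := by
        rw [add_comm ((1 - m) * t) m, mul_div_right_comm, div_mul_div_comm,
          mul_comm (m + (1 - m) * t), mul_div_right_comm]
    _ < m / b / (m + (1 - m) * t) *
        (s * (x2 ^ (2 * m - 1) / (x2 ^ (2 * m - 2) - b ^ (2 * m)))) := by gcongr
    _ = _ := by
        rw [hst]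
        have : m + m * s ≠ 0 := by positivity
        field_simp
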